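/- For every term t there exist a positive integer m, positive integers n₁, …, n_m, and basic terms t_{i,j} (for 1 ≤ i ≤ m, 1 ≤ j ≤ n_i) such that for every assignment h : ℕ → W of time warps to variables, eval h t = ⨅_{i=1}^{m} ⨆_{j=1}^{n_i} eval h t_{i,j}, where the finite infimum and supremum of time warps are taken pointwise. -/

import Mathlib

/-- A map `f : ℕ∞ → ℕ∞` preserves arbitrary suprema. -/
def PreservesSSup (f : ℕ∞ → ℕ∞) : Prop :=
  ∀ S : Set ℕ∞, f (sSup S) = sSup (f '' S)

/-- The predecessor time warp: `pred 0 = 0`, `pred ⊤ = ⊤`, `pred (n+1) = n`. -/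
def wpred (m : ℕ∞) : ℕ∞ := if m = ⊤ then ⊤ else ((m.toNat - 1 : ℕ) : ℕ∞)

/-- The involution `f⋆` of a time warp `f`: `f⋆ m = ⨅ {pred n | n ∈ ℕ∞, m ≤ f n}`. -/
noncomputable def winv (f : ℕ∞ → ℕ∞) : ℕ∞ → ℕ∞ :=
  fun m => sInf {y | ∃ n : ℕ∞, m ≤ f n ∧ y = wpred n}

/-- Terms in the language of the time warp algebra. -/
inductive Term : Type
  | var : ℕ → Term
  | one : Term
  | mul : Term → Term → Term
  | star : Term → Term
  | meet : Term → Term → Term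
  | join : Term → Term → Term

/-- Basic terms: built only from variables, `one`, `mul`, and `star`. -/
inductive IsBasic : Term → Prop
  | var (i : ℕ) : IsBasic (Term.var i)
  | one : IsBasic Term.one
  | mul {t u : Term} : IsBasic t → IsBasic u → IsBasic (Term.mul t u)
  | star {t : Term} : IsBasic t → IsBasic (Term.star t)

/-- Evaluation of a term under an assignment `h` of maps to variables. -/
noncomputable def eval (h : ℕ → ℕ∞ → ℕ∞) : Term → ℕ∞ → ℕ∞
  | Term.var i => h i
  | Term.one => id
  | Term.mul t u => eval h t ∘ eval h u
  | Term.star t => winv (eval h t)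
  | Term.meet t u => fun x => eval h t x ⊓ eval h u x
  | Term.join t u => fun x => eval h t x ⊔ eval h u x

theorem PreservesSSup.monotone {f : ℕ∞ → ℕ∞} (hf : PreservesSSup f) : Monotone f := by
  intro a b hab
  have h := hf {a, b}
  rw [sSup_pair, Set.image_pair, sSup_pair, sup_eq_right.2 hab] at h
  rw [h]
  exact le_sup_left

theorem winv_monotone (f : ℕ∞ → ℕ∞) : Monotone (winv f) := fun _ _ hab =>
  sInf_le_sInf fun _ ⟨n, hn, hy⟩ => ⟨n, hab.trans hn, hy⟩

theorem winv_antitone : Antitone winv := fun _ _ hfg _ =>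
  sInf_le_sInf fun _ ⟨n, hn, hy⟩ => ⟨n, hn.trans (hfg n), hy⟩

theorem winv_sup (f g : ℕ∞ → ℕ∞) (m : ℕ∞) :
    winv (fun x => f x ⊔ g x) m = winv f m ⊓ winv g m := by
  unfold winv
  rw [← sInf_union]
  congr 1
  ext y
  simp only [le_sup_iff, Set.mem_union, Set.mem_ofPred_eq, or_and_right, exists_or]

theorem winv_inf {f g : ℕ∞ → ℕ∞} (hf : Monotone f) (hg : Monotone g) (m : ℕ∞) :
    winv (fun x => f x ⊓ g x) m = winv f m ⊔ winv g m := by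
  apply le_antisymm
  · by_cases H : ∀ n, m ≤ f n → m ≤ g n
    · exact le_sup_of_le_left
        (sInf_le_sInf fun y ⟨n, hn, hy⟩ => ⟨n, le_inf hn (H n hn), hy⟩)
    · push Not at H
      obtain ⟨k, hk, hk'⟩ := H
      refine le_sup_of_le_right (sInf_le_sInf fun y ⟨n, hn, hy⟩ => ⟨n, le_inf ?_ hn, hy⟩)
      have hkn : k ≤ n := le_of_not_ge fun hnk => (hn.trans (hg hnk)).not_gt hk'
      exact hk.trans (hf hkn)
  · exact sup_le (winv_antitone (fun _ => inf_le_left) m)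
      (winv_antitone (fun _ => inf_le_right) m)

theorem eval_monotone {h : ℕ → ℕ∞ → ℕ∞} (hh : ∀ i, Monotone (h i)) (t : Term) :
    Monotone (eval h t) := by
  induction t with
  | var i => exact hh i
  | one => exact monotone_id
  | mul t u iht ihu => exact iht.comp ihu
  | star t _ => exact winv_monotone _
  | meet t u iht ihu => exact iht.inf ihu
  | join t u iht ihu => exact iht.sup ihu

/-- Terms built from basic terms by meets and joins. -/
inductive IsLatticeCombination : Term → Prop
  | basic {t : Term} : IsBasic t → IsLatticeCombination t
  | meet {t u : Term} : IsLatticeCombination t → IsLatticeCombination u →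
      IsLatticeCombination (Term.meet t u)
  | join {t u : Term} : IsLatticeCombination t → IsLatticeCombination u →
      IsLatticeCombination (Term.join t u)

/-- Two terms are equivalent if they agree under all assignments of monotone maps. -/
def MonotoneEquiv (t u : Term) : Prop :=
  ∀ h : ℕ → ℕ∞ → ℕ∞, (∀ i, Monotone (h i)) → eval h t = eval h u

theorem IsLatticeCombination.exists_mul {t u : Term} (ht : IsLatticeCombination t)
    (hu : IsLatticeCombination u) :
    ∃ v, IsLatticeCombination v ∧ MonotoneEquiv (Term.mul t u) v := by
  induction ht with
  | @basic t ht =>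
    induction hu with
    | @basic u hu => exact ⟨_, .basic (ht.mul hu), fun _ _ => rfl⟩
    | meet _ _ iha ihb =>
      obtain ⟨v, hv, ev⟩ := iha
      obtain ⟨w, hw, ew⟩ := ihb
      refine ⟨_, hv.meet hw, fun h hh => funext fun x => ?_⟩
      simp only [eval, ← ev h hh, ← ew h hh, Function.comp_apply]
      exact (eval_monotone hh t).map_inf _ _
    | join _ _ iha ihb =>
      obtain ⟨v, hv, ev⟩ := iha
      obtain ⟨w, hw, ew⟩ := ihb
      refine ⟨_, hv.join hw, fun h hh => funext fun x => ?_⟩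
      simp only [eval, ← ev h hh, ← ew h hh, Function.comp_apply]
      exact (eval_monotone hh t).map_sup _ _
  | meet _ _ iha ihb =>
    obtain ⟨v, hv, ev⟩ := iha
    obtain ⟨w, hw, ew⟩ := ihb
    refine ⟨_, hv.meet hw, fun h hh => funext fun x => ?_⟩
    simp only [eval, ← ev h hh, ← ew h hh, Function.comp_apply]
  | join _ _ iha ihb =>
    obtain ⟨v, hv, ev⟩ := iha
    obtain ⟨w, hw, ew⟩ := ihb
    refine ⟨_, hv.join hw, fun h hh => funext fun x => ?_⟩
    simp only [eval, ← ev h hh, ← ew h hh, Function.comp_apply]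

theorem IsLatticeCombination.exists_star {t : Term} (ht : IsLatticeCombination t) :
    ∃ v, IsLatticeCombination v ∧ MonotoneEquiv (Term.star t) v := by
  induction ht with
  | basic ht => exact ⟨_, .basic ht.star, fun _ _ => rfl⟩
  | meet _ _ iha ihb =>
    obtain ⟨v, hv, ev⟩ := iha
    obtain ⟨w, hw, ew⟩ := ihb
    refine ⟨_, hv.join hw, fun h hh => funext fun x => ?_⟩
    simp only [eval, ← ev h hh, ← ew h hh]
    exact winv_inf (eval_monotone hh _) (eval_monotone hh _) x
  | join _ _ iha ihb =>
    obtain ⟨v, hv, ev⟩ := iha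
    obtain ⟨w, hw, ew⟩ := ihb
    refine ⟨_, hv.meet hw, fun h hh => funext fun x => ?_⟩
    simp only [eval, ← ev h hh, ← ew h hh]
    exact winv_sup _ _ x

theorem exists_isLatticeCombination (t : Term) :
    ∃ v, IsLatticeCombination v ∧ MonotoneEquiv t v := by
  induction t with
  | var i => exact ⟨_, .basic (.var i), fun _ _ => rfl⟩
  | one => exact ⟨_, .basic .one, fun _ _ => rfl⟩
  | mul t u iht ihu =>
    obtain ⟨v, hv, ev⟩ := iht
    obtain ⟨w, hw, ew⟩ := ihu
    obtain ⟨r, hr, er⟩ := hv.exists_mul hw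
    exact ⟨r, hr, fun h hh => by rw [← er h hh]; simp only [eval, ev h hh, ew h hh]⟩
  | star t iht =>
    obtain ⟨v, hv, ev⟩ := iht
    obtain ⟨r, hr, er⟩ := hv.exists_star
    exact ⟨r, hr, fun h hh => by rw [← er h hh]; simp only [eval, ev h hh]⟩
  | meet t u iht ihu =>
    obtain ⟨v, hv, ev⟩ := iht
    obtain ⟨w, hw, ew⟩ := ihu
    exact ⟨_, hv.meet hw, fun h hh => by simp only [eval, ev h hh, ew h hh]⟩
  | join t u iht ihu =>
    obtain ⟨v, hv, ev⟩ := iht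
    obtain ⟨w, hw, ew⟩ := ihu
    exact ⟨_, hv.join hw, fun h hh => by simp only [eval, ev h hh, ew h hh]⟩

theorem IsLatticeCombination.exists_iInf_iSup {t : Term} (ht : IsLatticeCombination t) :
    ∃ (ι : Type) (_ : Finite ι) (_ : Nonempty ι) (κ : ι → Type) (_ : ∀ i, Finite (κ i))
      (_ : ∀ i, Nonempty (κ i)) (ts : (i : ι) → κ i → Term), (∀ i j, IsBasic (ts i j)) ∧
      ∀ h x, eval h t x = ⨅ i, ⨆ j, eval h (ts i j) x := by
  induction ht with
  | @basic t ht =>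
    exact ⟨Unit, inferInstance, inferInstance, fun _ => Unit, inferInstance, inferInstance,
      fun _ _ => t, fun _ _ => ht, fun h x => by simp⟩
  | meet _ _ iha ihb =>
    obtain ⟨ι, _, _, κ, hκ, hκ', ts, hts, ets⟩ := iha
    obtain ⟨ι', _, _, μ, hμ, hμ', us, hus, eus⟩ := ihb
    refine ⟨ι ⊕ ι', inferInstance, inferInstance, Sum.elim κ μ, Sum.rec hκ hμ, Sum.rec hκ' hμ',
      Sum.rec ts us, Sum.rec hts hus, fun h x => ?_⟩
    rw [iInf_sum]
    exact congrArg₂ (· ⊓ ·) (ets h x) (eus h x)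
  | join _ _ iha ihb =>
    obtain ⟨ι, _, _, κ, hκ, hκ', ts, hts, ets⟩ := iha
    obtain ⟨ι', _, _, μ, hμ, hμ', us, hus, eus⟩ := ihb
    refine ⟨ι × ι', inferInstance, inferInstance, fun p => κ p.1 ⊕ μ p.2, inferInstance,
      inferInstance, fun p => Sum.elim (ts p.1) (us p.2),
      fun p => Sum.rec (hts p.1) (hus p.2), fun h x => ?_⟩
    simp only [eval, ets, eus, iSup_sum, Sum.elim_inl, Sum.elim_inr]
    exact iInf_sup_iInf

/-- Every term is equivalent, in the time warp algebra, to a meet of joins of basic terms. -/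
theorem stmt11 (t : Term) :
    ∃ (m : ℕ) (_ : 0 < m) (ns : Fin m → ℕ) (_ : ∀ i, 0 < ns i)
      (ts : (i : Fin m) → Fin (ns i) → Term),
      (∀ i j, IsBasic (ts i j)) ∧
      ∀ h : ℕ → ℕ∞ → ℕ∞, (∀ i, PreservesSSup (h i)) →
        ∀ x, eval h t x = ⨅ i, ⨆ j, eval h (ts i j) x := by
  obtain ⟨v, hv, ev⟩ := exists_isLatticeCombination t
  obtain ⟨ι, _, _, κ, _, _, ts, hts, ets⟩ := hv.exists_iInf_iSup
  let e := (Finite.equivFin ι).symm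
  let d := fun i => (Finite.equivFin (κ i)).symm
  refine ⟨Nat.card ι, Nat.card_pos, fun i => Nat.card (κ (e i)), fun _ => Nat.card_pos,
    fun i j => ts (e i) (d (e i) j), fun _ _ => hts _ _, fun h hh x => ?_⟩
  rw [ev h fun i => (hh i).monotone, ets, ← e.iInf_comp]
  exact iInf_congr fun i => ((d (e i)).iSup_comp (g := fun j => eval h (ts (e i) j) x)).symm
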